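/- Uniqueness for the Stefan integral equation: if z and z̃ are both continuous nondecreasing functions on [1/2, ∞) with z(1/2) = z̃(1/2) = 0 that satisfy, for all t > 1/2, ∫₀^∞ p(t − 1/2, z(t) − y) U_{**}(y) dy = ∫_{1/2}^t p(t−s, z(t) − z(s)) ds (and the same equation for z̃), then z = z̃. -/

import Mathlib

open MeasureTheory Real Set

/-- The heat kernel `p(t,x) = (2πt)^{-1/2} exp(-x²/(2t))`. -/
noncomputable def heatK (t x : ℝ) : ℝ :=
  (Real.sqrt (2 * Real.pi * t))⁻¹ * Real.exp (-x ^ 2 / (2 * t))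

/-- The Gaussian tail `Φ̃(t,x) = ∫ₓ^∞ p(t,y) dy`. -/
noncomputable def gaussTail (t x : ℝ) : ℝ := ∫ y in Set.Ioi x, heatK t y

/-- The density `u₁(t,x) = -2∂ₓp(t,x) + 4Φ̃(t,x) = (2x/t)p(t,x) + 4Φ̃(t,x)`. -/
noncomputable def u1 (t x : ℝ) : ℝ := (2 * x / t) * heatK t x + 4 * gaussTail t x

/-- The profile `U_{**}(y) = ∫₀^y u₁(1/2, w) dw`. -/
noncomputable def Ustst (y : ℝ) : ℝ := ∫ w in (0:ℝ)..y, u1 (1 / 2) w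

lemma heatK_nonneg (t x : ℝ) : 0 ≤ heatK t x := by
  unfold heatK; positivity

lemma continuous_heatK (t : ℝ) : Continuous (heatK t) := by
  unfold heatK; fun_prop

lemma heatK_eq_mul_exp (t x : ℝ) :
    heatK t x = (√(2 * π * t))⁻¹ * exp (-(1 / (2 * t)) * x ^ 2) := by
  unfold heatK
  congr 2
  ring

lemma integrable_heatK {t : ℝ} (ht : 0 < t) : Integrable (heatK t) := by
  have h := (integrable_exp_neg_mul_sq (b := 1 / (2 * t)) (by positivity)).const_mul
    (√(2 * π * t))⁻¹
  exact h.congr (.of_forall fun x => (heatK_eq_mul_exp t x).symm)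

lemma integrable_abs_mul_heatK {t : ℝ} (ht : 0 < t) : Integrable fun x => |x| * heatK t x := by
  have h := ((integrable_mul_exp_neg_mul_sq (b := 1 / (2 * t)) (by positivity)).const_mul
    (√(2 * π * t))⁻¹).abs
  refine h.congr (.of_forall fun x => ?_)
  simp only [heatK_eq_mul_exp, abs_mul, abs_exp]
  rw [abs_of_nonneg (a := (√(2 * π * t))⁻¹) (by positivity)]
  ring

lemma heatK_lt_heatK {t x y : ℝ} (ht : 0 < t) (hx : 0 ≤ x) (hxy : x < y) :
    heatK t y < heatK t x := by
  have hsq : x ^ 2 < y ^ 2 := by gcongr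
  unfold heatK
  gcongr

lemma heatK_le {t : ℝ} (ht : 0 ≤ t) (x : ℝ) : heatK t x ≤ (√(2 * π * t))⁻¹ := by
  unfold heatK
  refine mul_le_of_le_one_right (by positivity) (exp_le_one_iff.2 ?_)
  rw [neg_div, neg_nonpos]
  positivity

lemma gaussTail_nonneg (t x : ℝ) : 0 ≤ gaussTail t x :=
  integral_nonneg fun _ => heatK_nonneg _ _

lemma antitone_gaussTail {t : ℝ} (ht : 0 < t) : Antitone (gaussTail t) := fun _ _ hxy =>
  setIntegral_mono_set (integrable_heatK ht).integrableOn (.of_forall fun _ => heatK_nonneg _ _)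
    (Ioi_subset_Ioi hxy).eventuallyLE

lemma u1_nonneg {t x : ℝ} (ht : 0 ≤ t) (hx : 0 ≤ x) : 0 ≤ u1 t x := by
  have := heatK_nonneg t x
  have := gaussTail_nonneg t x
  unfold u1
  positivity

lemma intervalIntegrable_u1 {t : ℝ} (ht : 0 < t) (a b : ℝ) :
    IntervalIntegrable (u1 t) volume a b := by
  have hc : Continuous fun x => 2 * x / t * heatK t x :=
    (by fun_prop : Continuous fun x : ℝ => 2 * x / t).mul (continuous_heatK t)
  exact (hc.intervalIntegrable a b).add ((antitone_gaussTail ht).intervalIntegrable.const_mul 4)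

lemma Ustst_zero : Ustst 0 = 0 := by simp [Ustst]

lemma monotoneOn_Ustst : MonotoneOn Ustst (Ici 0) := by
  intro x hx y _ hxy
  have h := intervalIntegral.integral_add_adjacent_intervals
    (intervalIntegrable_u1 one_half_pos 0 x) (intervalIntegrable_u1 one_half_pos x y)
  have : 0 ≤ ∫ w in x..y, u1 (1 / 2) w := intervalIntegral.integral_nonneg hxy fun w hw =>
    u1_nonneg (by norm_num) (le_trans hx hw.1)
  unfold Ustst
  linarith

/-- The extension of `Ustst` by zero to the negative half-line. -/
noncomputable def UststExt (y : ℝ) : ℝ := Ustst (max y 0)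

lemma monotone_UststExt : Monotone UststExt := fun x y hxy =>
  monotoneOn_Ustst (le_max_right x 0) (le_max_right y 0) (max_le_max_right 0 hxy)

lemma UststExt_nonneg (y : ℝ) : 0 ≤ UststExt y :=
  Ustst_zero.symm.le.trans (monotoneOn_Ustst self_mem_Ici (le_max_right y 0) (le_max_right y 0))

/-- `Ustst` grows at most affinely, since `x ↦ x * heatK t x` is integrable and the Gaussian tail
is bounded by its value at zero on the positive half-line. -/
lemma exists_UststExt_le : ∃ A B : ℝ, 0 ≤ B ∧ ∀ y, UststExt y ≤ A + B * |y| := by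
  have hp : (0 : ℝ) < 1 / 2 := by norm_num
  have hint := (integrable_abs_mul_heatK hp).const_mul 4
  refine ⟨∫ w, 4 * (|w| * heatK (1 / 2) w), 4 * gaussTail (1 / 2) 0,
    mul_nonneg (by norm_num) (gaussTail_nonneg _ _), fun y => ?_⟩
  set m := max y 0
  have hm : 0 ≤ m := le_max_right y 0
  have hmy : m ≤ |y| := max_le (le_abs_self y) (abs_nonneg y)
  calc UststExt y ≤ ∫ w in (0 : ℝ)..m, (4 * (|w| * heatK (1 / 2) w) + 4 * gaussTail (1 / 2) 0) := by
        refine intervalIntegral.integral_mono_on hm (intervalIntegrable_u1 hp _ _)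
          (hint.intervalIntegrable.add intervalIntegrable_const) fun w hw => ?_
        have := antitone_gaussTail hp hw.1
        rw [abs_of_nonneg hw.1]
        unfold u1
        linarith
    _ = (∫ w in (0 : ℝ)..m, 4 * (|w| * heatK (1 / 2) w)) + m * (4 * gaussTail (1 / 2) 0) := by
        rw [intervalIntegral.integral_add hint.intervalIntegrable intervalIntegrable_const]
        simp only [intervalIntegral.integral_const, smul_eq_mul, sub_zero]
    _ ≤ _ := by
        rw [mul_comm m]
        gcongr
        · rw [intervalIntegral.integral_of_le hm]
          exact setIntegral_le_integral hint (.of_forall fun w =>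
            mul_nonneg (by norm_num) (mul_nonneg (abs_nonneg w) (heatK_nonneg _ w)))
        · exact mul_nonneg (by norm_num) (gaussTail_nonneg _ _)

lemma integrable_heatK_mul_UststExt {t : ℝ} (ht : 0 < t) (x : ℝ) :
    Integrable fun v => heatK t v * UststExt (x - v) := by
  obtain ⟨A, B, hB, hAB⟩ := exists_UststExt_le
  refine (((integrable_heatK ht).const_mul (A + B * |x|)).add
    ((integrable_abs_mul_heatK ht).const_mul B)).mono' ?_ (.of_forall fun v => ?_)
  · exact ((continuous_heatK t).measurable.mul
      (monotone_UststExt.measurable.comp (measurable_const.sub measurable_id))).aestronglyMeasurable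
  · rw [norm_of_nonneg (mul_nonneg (heatK_nonneg _ _) (UststExt_nonneg _))]
    have h : UststExt (x - v) ≤ A + B * (|x| + |v|) :=
      (hAB _).trans (by gcongr; exact abs_sub x v)
    have := mul_le_mul_of_nonneg_left h (heatK_nonneg t v)
    simp only [Pi.add_apply]
    linarith

lemma integral_heatK_mul_Ustst (t x : ℝ) :
    ∫ y in Ioi (0 : ℝ), heatK t (x - y) * Ustst y = ∫ v, heatK t v * UststExt (x - v) := by
  rw [← integral_sub_left_eq_self (fun v => heatK t v * UststExt (x - v)) volume x,
    ← integral_indicator measurableSet_Ioi]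
  congr 1 with y
  by_cases hy : 0 < y
  · simp [hy, UststExt, hy.le]
  · simp [hy, UststExt, le_of_not_gt hy, Ustst_zero]

lemma monotone_integral_heatK_mul_Ustst {t : ℝ} (ht : 0 < t) :
    Monotone fun x => ∫ y in Ioi (0 : ℝ), heatK t (x - y) * Ustst y := by
  intro x x' hx
  simp only [integral_heatK_mul_Ustst]
  refine integral_mono (integrable_heatK_mul_UststExt ht x) (integrable_heatK_mul_UststExt ht x')
    fun v => ?_
  have := heatK_nonneg t v
  have := monotone_UststExt (sub_le_sub_right hx v)
  dsimp only
  gcongr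

lemma intervalIntegrable_heatK_sub {z : ℝ → ℝ} {a t : ℝ} (hat : a ≤ t)
    (hz : ContinuousOn z (Ici a)) :
    IntervalIntegrable (fun s => heatK (t - s) (z t - z s)) volume a t := by
  have hdom : IntervalIntegrable (fun s => (√(2 * π * (t - s)))⁻¹) volume a t := by
    have h := ((intervalIntegral.intervalIntegrable_rpow' (a := t - a) (b := 0)
      (r := -(1 / 2)) (by norm_num)).comp_sub_left t).const_mul (√(2 * π))⁻¹
    simp only [sub_sub_cancel, sub_zero] at h
    refine h.congr fun s hs => ?_
    rw [uIoc_of_le hat] at hs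
    have hs' : 0 ≤ t - s := sub_nonneg.2 hs.2
    rw [rpow_neg hs', ← sqrt_eq_rpow, sqrt_mul (x := 2 * π) (by positivity) (t - s), mul_inv]
  refine hdom.mono_fun ?_ ?_
  · rw [uIoc_of_le hat]
    have hzm : AEMeasurable z (volume.restrict (Ioc a t)) :=
      (hz.mono fun s hs => hs.1.le).aemeasurable measurableSet_Ioc
    unfold heatK
    exact AEMeasurable.aestronglyMeasurable (by fun_prop)
  · rw [uIoc_of_le hat]
    refine (ae_restrict_mem measurableSet_Ioc).mono fun s hs => ?_
    dsimp only
    rw [norm_of_nonneg (heatK_nonneg _ _), norm_of_nonneg (by positivity)]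
    exact heatK_le (sub_nonneg.2 hs.2) _

/-- Sliding comparison: a solution cannot cross an upward translate of another solution. -/
lemma stefan_integral_equation_lt_add {z z' : ℝ → ℝ}
    (hzc : ContinuousOn z (Ici (1 / 2 : ℝ)))
    (hz0 : z (1 / 2) = 0)
    (hzeq : ∀ t > (1 / 2 : ℝ),
      (∫ y in Ioi (0 : ℝ), heatK (t - 1 / 2) (z t - y) * Ustst y)
        = ∫ s in (1 / 2 : ℝ)..t, heatK (t - s) (z t - z s))
    (hz'c : ContinuousOn z' (Ici (1 / 2 : ℝ)))
    (hz'm : MonotoneOn z' (Ici (1 / 2 : ℝ)))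
    (hz'0 : z' (1 / 2) = 0)
    (hz'eq : ∀ t > (1 / 2 : ℝ),
      (∫ y in Ioi (0 : ℝ), heatK (t - 1 / 2) (z' t - y) * Ustst y)
        = ∫ s in (1 / 2 : ℝ)..t, heatK (t - s) (z' t - z' s))
    {ε : ℝ} (hε : 0 < ε) {T : ℝ} (hT : 1 / 2 ≤ T) : z T < z' T + ε := by
  by_contra! hcross
  have hsub : Icc (1 / 2) T ⊆ Ici (1 / 2 : ℝ) := fun s hs => hs.1
  set S := {s ∈ Icc (1 / 2) T | z' s + ε ≤ z s}
  have hS : IsCompact S := isCompact_Icc.of_isClosed_subset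
    (isClosed_Icc.isClosed_le ((hz'c.mono hsub).add continuousOn_const) (hzc.mono hsub))
    (sep_subset _ _)
  obtain ⟨t, ⟨⟨ht, htT⟩, htz⟩, hmin⟩ := hS.exists_isLeast ⟨T, ⟨hT, le_rfl⟩, hcross⟩
  have ht' : 1 / 2 < t := by
    refine ht.lt_of_ne fun h => ?_
    rw [← h, hz0, hz'0] at htz
    linarith
  have hbefore : ∀ s ∈ Ioo (1 / 2) t, z s < z' s + ε := fun s hs => by
    by_contra! h
    exact hs.2.not_ge (hmin ⟨⟨hs.1.le, hs.2.le.trans htT⟩, h⟩)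
  have hi := intervalIntegrable_heatK_sub ht hzc
  have hi' := intervalIntegrable_heatK_sub ht hz'c
  have hpos := intervalIntegral.intervalIntegral_pos_of_pos_on (hi'.sub hi) (fun s hs =>
    sub_pos.2 (heatK_lt_heatK (sub_pos.2 hs.2)
      (sub_nonneg.2 (hz'm hs.1.le ht hs.2.le)) (by linarith [hbefore s hs]))) ht'
  rw [intervalIntegral.integral_sub hi' hi, ← hzeq t ht', ← hz'eq t ht'] at hpos
  have hmono := monotone_integral_heatK_mul_Ustst (sub_pos.2 ht') (show z' t ≤ z t by linarith)
  dsimp only at hmono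
  linarith

/-- Uniqueness for the Stefan integral equation: two continuous nondecreasing functions on
`[1/2,∞)` vanishing at `1/2` that both satisfy, for all `t > 1/2`,
`∫₀^∞ p(t-1/2, z(t)-y) U_{**}(y) dy = ∫_{1/2}^t p(t-s, z(t)-z(s)) ds` must coincide. -/
theorem stefan_integral_equation_uniqueness (z z' : ℝ → ℝ)
    (hzc : ContinuousOn z (Set.Ici (1/2 : ℝ)))
    (hzm : MonotoneOn z (Set.Ici (1/2 : ℝ)))
    (hz0 : z (1/2) = 0)
    (hzeq : ∀ t > (1/2 : ℝ),
      (∫ y in Set.Ioi (0:ℝ), heatK (t - 1/2) (z t - y) * Ustst y)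
        = ∫ s in (1/2 : ℝ)..t, heatK (t - s) (z t - z s))
    (hz'c : ContinuousOn z' (Set.Ici (1/2 : ℝ)))
    (hz'm : MonotoneOn z' (Set.Ici (1/2 : ℝ)))
    (hz'0 : z' (1/2) = 0)
    (hz'eq : ∀ t > (1/2 : ℝ),
      (∫ y in Set.Ioi (0:ℝ), heatK (t - 1/2) (z' t - y) * Ustst y)
        = ∫ s in (1/2 : ℝ)..t, heatK (t - s) (z' t - z' s)) :
    Set.EqOn z z' (Set.Ici (1/2 : ℝ)) := by
  intro T hT
  refine le_antisymm (le_of_forall_pos_le_add fun ε hε => ?_)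
    (le_of_forall_pos_le_add fun ε hε => ?_)
  · exact (stefan_integral_equation_lt_add hzc hz0 hzeq hz'c hz'm hz'0 hz'eq hε hT).le
  · exact (stefan_integral_equation_lt_add hz'c hz'0 hz'eq hzc hzm hz0 hzeq hε hT).le
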